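/- arXiv:math/0503228 — 3 statements merged into one kernel-verified Lean document; each statement's English description precedes it below -/
import Mathlib

section
/- Let Γ = (R,S) be a finite binary relation. Then the iterated quotients C_l(C_r Γ) and C_r(C_l Γ) determine the same partition of S into equivalence classes, and the induced binary relations on this common quotient set coincide; in particular C_l C_r Γ and C_r C_l Γ are graph-isomorphic. -/
open Polynomial

namespace Towber

/-- A transformation-pair over `K`: two `K`-linear maps between
finite-dimensional `K`-vector spaces. -/
structure Pair (K : Type) [Field K] where
  E : Type
  V : Type
  [addE : AddCommGroup E]
  [modE : Module K E]
  [finE : FiniteDimensional K E]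
  [addV : AddCommGroup V]
  [modV : Module K V]
  [finV : FiniteDimensional K V]
  mu : E →ₗ[K] V
  nu : E →ₗ[K] V

attribute [instance] Pair.addE Pair.modE Pair.finE Pair.addV Pair.modV Pair.finV

variable (K : Type) [Field K]

/-- Isomorphism of transformation-pairs. -/
def Pair.Iso (τ σ : Pair K) : Prop :=
  ∃ (α : τ.E ≃ₗ[K] σ.E) (β : τ.V ≃ₗ[K] σ.V),
    (∀ x, σ.mu (α x) = β (τ.mu x)) ∧ (∀ x, σ.nu (α x) = β (τ.nu x))

/-- Finite direct sum of transformation-pairs. -/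
noncomputable def dSum (ι : Type) [Finite ι] (τ : ι → Pair K) : Pair K :=
  letI := Fintype.ofFinite ι
  { E := ∀ i, (τ i).E
    V := ∀ i, (τ i).V
    mu := LinearMap.pi fun i => (τ i).mu ∘ₗ LinearMap.proj i
    nu := LinearMap.pi fun i => (τ i).nu ∘ₗ LinearMap.proj i }

/-- Binary direct sum of transformation-pairs. -/
noncomputable def dSum2 (τ σ : Pair K) : Pair K where
  E := τ.E × σ.E
  V := τ.V × σ.V
  mu := τ.mu.prodMap σ.mu
  nu := τ.nu.prodMap σ.nu

/-- A transformation-pair built from a pair of matrices. -/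
noncomputable def ofMats {a b : ℕ} (M N : Matrix (Fin b) (Fin a) K) : Pair K where
  E := Fin a → K
  V := Fin b → K
  mu := Matrix.toLin' M
  nu := Matrix.toLin' N

/-- `^0T_n = [μ_n, I : K^n → K^n]`, where `μ_n` maps `f_i ↦ f_{i+1}`, `f_n ↦ 0`. -/
noncomputable def zT (n : ℕ) : Pair K :=
  ofMats K (Matrix.of fun j i : Fin n => if (i : ℕ) + 1 = (j : ℕ) then 1 else 0) 1

/-- `T^0_n = [I, μ_n : K^n → K^n]`. -/
noncomputable def Tz (n : ℕ) : Pair K :=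
  ofMats K 1 (Matrix.of fun j i : Fin n => if (i : ℕ) + 1 = (j : ℕ) then 1 else 0)

/-- `T_n = [κ_n, λ_n : K^n → K^{n+1}]`, `κ_n : f_i ↦ f_i`, `λ_n : f_i ↦ f_{i+1}`. -/
noncomputable def Tn (n : ℕ) : Pair K :=
  ofMats K (Matrix.of fun (j : Fin (n+1)) (i : Fin n) => if (j : ℕ) = (i : ℕ) then 1 else 0)
    (Matrix.of fun (j : Fin (n+1)) (i : Fin n) => if (j : ℕ) = (i : ℕ) + 1 then 1 else 0)

/-- `^0T^0_n = [κ'_n, λ'_n : K^{n+1} → K^n]`. -/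
noncomputable def zTz (n : ℕ) : Pair K :=
  ofMats K (Matrix.of fun (j : Fin n) (i : Fin (n+1)) => if (j : ℕ) = (i : ℕ) then 1 else 0)
    (Matrix.of fun (j : Fin n) (i : Fin (n+1)) => if (j : ℕ) + 1 = (i : ℕ) then 1 else 0)

/-- `S(F) = [·X, I : K[X]/(F) → K[X]/(F)]` for a nonzero polynomial `F`. -/
noncomputable def SP (F : Polynomial K) (hF : F ≠ 0) : Pair K :=
  letI : FiniteDimensional K (AdjoinRoot F) := (AdjoinRoot.powerBasis hF).finite
  { E := AdjoinRoot F
    V := AdjoinRoot F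
    mu := LinearMap.mulLeft K (AdjoinRoot.root F)
    nu := LinearMap.id }

/-- Membership in Kronecker's list `L(K)` (up to isomorphism). -/
def IsKron (σ : Pair K) : Prop :=
  (∃ n, 1 ≤ n ∧ Pair.Iso K σ (zT K n)) ∨
  (∃ n, 1 ≤ n ∧ Pair.Iso K σ (Tz K n)) ∨
  (∃ n, Pair.Iso K σ (Tn K n)) ∨
  (∃ n, Pair.Iso K σ (zTz K n)) ∨
  (∃ (p : Polynomial K) (n : ℕ), p.Monic ∧ Irreducible p ∧ p ≠ X ∧ 1 ≤ n ∧
    ∃ h : p ^ n ≠ 0, Pair.Iso K σ (SP K (p ^ n) h))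

/-- Being of type `S(p^n)` with `p` monic irreducible, `p ≠ X`, `n ≥ 1`. -/
def IsSType (σ : Pair K) : Prop :=
  ∃ (p : Polynomial K) (n : ℕ), p.Monic ∧ Irreducible p ∧ p ≠ X ∧ 1 ≤ n ∧
    ∃ h : p ^ n ≠ 0, Pair.Iso K σ (SP K (p ^ n) h)

/-- Membership in Weierstrass' (regular) part of Kronecker's list. -/
def IsKronReg (σ : Pair K) : Prop :=
  (∃ n, 1 ≤ n ∧ Pair.Iso K σ (zT K n)) ∨
  (∃ n, 1 ≤ n ∧ Pair.Iso K σ (Tz K n)) ∨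
  (∃ (p : Polynomial K) (n : ℕ), p.Monic ∧ Irreducible p ∧ p ≠ X ∧ 1 ≤ n ∧
    ∃ h : p ^ n ≠ 0, Pair.Iso K σ (SP K (p ^ n) h))

/-- A finite binary relation `(R, S)`. -/
structure BRel where
  S : Type
  R : S → S → Prop
  [fin : Finite S]

attribute [instance] BRel.fin

/-- The generating relation for left contraction:
`y ~ y'` whenever `∃ x, xRy ∧ xRy'`. -/
def BRel.lgen (Γ : BRel) : Γ.S → Γ.S → Prop := fun y y' => ∃ x, Γ.R x y ∧ Γ.R x y'

/-- The generating relation for right contraction: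
`x ~ x'` whenever `∃ y, xRy ∧ x'Ry`. -/
def BRel.rgen (Γ : BRel) : Γ.S → Γ.S → Prop := fun x x' => ∃ y, Γ.R x y ∧ Γ.R x' y

/-- Quotient of a binary relation by (the equivalence relation generated by) `r`:
two classes are related iff some representatives are related. -/
def BRel.quotBy (Γ : BRel) (r : Γ.S → Γ.S → Prop) : BRel where
  S := Quot r
  R := fun α β => ∃ a b, Quot.mk r a = α ∧ Quot.mk r b = β ∧ Γ.R a b

/-- Left contraction `C_l Γ`. -/
def BRel.Cl (Γ : BRel) : BRel := Γ.quotBy Γ.lgen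

/-- Right contraction `C_r Γ`. -/
def BRel.Cr (Γ : BRel) : BRel := Γ.quotBy Γ.rgen

/-- Graph-isomorphism of binary relations. -/
def BRel.Iso (Γ Δ : BRel) : Prop :=
  ∃ φ : Γ.S ≃ Δ.S, ∀ a b, Δ.R (φ a) (φ b) ↔ Γ.R a b

/-- `γ_{m,n}(Γ)`, the number of vertices of `C_l^m C_r^n Γ`. -/
noncomputable def BRel.gamma (Γ : BRel) (m n : ℕ) : ℕ :=
  Nat.card ((BRel.Cl^[m] (BRel.Cr^[n] Γ)).S)

/-- `Γ` has stabilized at `N`: for all `m, n ≥ N` the iterated contraction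
`C_l^m C_r^n Γ` is graph-isomorphic to `C_l^N C_r^N Γ`. -/
def BRel.StabAt (Γ : BRel) (N : ℕ) : Prop :=
  ∀ m, N ≤ m → ∀ n, N ≤ n →
    BRel.Iso (BRel.Cl^[m] (BRel.Cr^[n] Γ)) (BRel.Cl^[N] (BRel.Cr^[N] Γ))

/-- Number of edges of a binary relation. -/
noncomputable def BRel.edges (Γ : BRel) : ℕ :=
  Nat.card {p : Γ.S × Γ.S // Γ.R p.1 p.2}

/-- The `K`-linearization of a finite binary relation. -/
noncomputable def BRel.linz (Γ : BRel) : Pair K :=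
  letI := Fintype.ofFinite Γ.S
  letI := Classical.decEq Γ.S
  letI : DecidablePred (fun p : Γ.S × Γ.S => Γ.R p.1 p.2) := Classical.decPred _
  { E := {p : Γ.S × Γ.S // Γ.R p.1 p.2} → K
    V := Γ.S → K
    mu := Matrix.toLin' (Matrix.of fun (v : Γ.S) (e : {p : Γ.S × Γ.S // Γ.R p.1 p.2}) =>
      if e.1.1 = v then 1 else 0)
    nu := Matrix.toLin' (Matrix.of fun (v : Γ.S) (e : {p : Γ.S × Γ.S // Γ.R p.1 p.2}) =>
      if e.1.2 = v then 1 else 0) }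

/-- The disjoint union of the paths `L_{m i}` (on `m i` vertices) and the
cycles `C_{c j}` (on `c j` vertices). -/
def modelGraph (p q : ℕ) (m : Fin p → ℕ) (c : Fin q → ℕ) : BRel where
  S := (Σ i, Fin (m i)) ⊕ (Σ j, Fin (c j))
  R := fun x y =>
    (∃ (i : Fin p) (a b : Fin (m i)),
        x = Sum.inl ⟨i, a⟩ ∧ y = Sum.inl ⟨i, b⟩ ∧ (b : ℕ) = (a : ℕ) + 1) ∨
    (∃ (j : Fin q) (a b : Fin (c j)),
        x = Sum.inr ⟨j, a⟩ ∧ y = Sum.inr ⟨j, b⟩ ∧ (b : ℕ) = ((a : ℕ) + 1) % (c j))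

/-- A finite directed graph, possibly with parallel edges. -/
structure DiGraph where
  E : Type
  V : Type
  [finE : Finite E]
  [finV : Finite V]
  init : E → V
  term : E → V

attribute [instance] DiGraph.finE DiGraph.finV

/-- The parallelism relation on the edges of a directed graph. -/
def DiGraph.par (G : DiGraph) : G.E → G.E → Prop :=
  fun e e' => G.init e = G.init e' ∧ G.term e = G.term e'

/-- The reduced form of a directed graph: edges are parallelism classes. -/
def DiGraph.red (G : DiGraph) : DiGraph where
  E := Quot G.par
  V := G.V
  init := Quot.lift G.init fun _ _ h => h.1
  term := Quot.lift G.term fun _ _ h => h.2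

/-- The `K`-linearization of a finite directed graph. -/
noncomputable def DiGraph.linz (G : DiGraph) : Pair K :=
  letI := Fintype.ofFinite G.E
  letI := Fintype.ofFinite G.V
  letI := Classical.decEq G.V
  letI := Classical.decEq G.E
  { E := G.E → K
    V := G.V → K
    mu := Matrix.toLin' (Matrix.of fun (v : G.V) (e : G.E) => if G.init e = v then 1 else 0)
    nu := Matrix.toLin' (Matrix.of fun (v : G.V) (e : G.E) => if G.term e = v then 1 else 0) }

/-- If `a` and `b` have the same class under the relation of having a common successor, then any
successor of `a` and any successor of `b` have the same class under the relation of having a common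
predecessor. -/
theorem quot_mk_eq_of_rel {α : Type*} (R : α → α → Prop) {a b y z : α}
    (hab : Quot.mk (fun x x' => ∃ y, R x y ∧ R x' y) a =
      Quot.mk (fun x x' => ∃ y, R x y ∧ R x' y) b)
    (hy : R a y) (hz : R b z) :
    Quot.mk (fun y y' => ∃ x, R x y ∧ R x y') y =
      Quot.mk (fun y y' => ∃ x, R x y ∧ R x y') z := by
  let N : α → Set (Quot fun y y' => ∃ x, R x y ∧ R x y') :=
    fun x => {q | ∃ y, R x y ∧ Quot.mk _ y = q}
  have hN : ∀ x x', (∃ y, R x y ∧ R x' y) → N x = N x' := by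
    rintro x x' ⟨w, hw, hw'⟩
    ext q
    constructor
    · rintro ⟨u, hu, rfl⟩
      exact ⟨w, hw', Quot.sound ⟨x, hw, hu⟩⟩
    · rintro ⟨u, hu, rfl⟩
      exact ⟨w, hw, Quot.sound ⟨x', hw', hu⟩⟩
  have hNab : N a = N b := congrArg (Quot.lift N hN) hab
  have hmem : Quot.mk _ y ∈ N b := hNab ▸ ⟨y, hy, rfl⟩
  obtain ⟨u, hu, huy⟩ := hmem
  exact huy.symm.trans (Quot.sound ⟨b, hu, hz⟩)

/-- The class map `S → S(C_r C_l Γ)` descends to `C_r Γ`. -/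
def BRel.crToClCr (Γ : BRel) : Γ.Cr.S → Γ.Cl.Cr.S :=
  Quot.lift (fun a => Quot.mk Γ.Cl.rgen (Quot.mk Γ.lgen a)) fun a b ⟨y, ha, hb⟩ =>
    Quot.sound ⟨Quot.mk _ y, ⟨a, y, rfl, rfl, ha⟩, ⟨b, y, rfl, rfl, hb⟩⟩

/-- The class map `S → S(C_l C_r Γ)` descends to `C_l Γ`. -/
def BRel.clToCrCl (Γ : BRel) : Γ.Cl.S → Γ.Cr.Cl.S :=
  Quot.lift (fun a => Quot.mk Γ.Cr.lgen (Quot.mk Γ.rgen a)) fun a b ⟨x, ha, hb⟩ =>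
    Quot.sound ⟨Quot.mk _ x, ⟨x, a, rfl, rfl, ha⟩, ⟨x, b, rfl, rfl, hb⟩⟩

theorem BRel.crToClCr_eq (Γ : BRel) (α β : Γ.Cr.S) (h : Γ.Cr.lgen α β) :
    Γ.crToClCr α = Γ.crToClCr β := by
  obtain ⟨ξ, ⟨a, y, rfl, rfl, hy⟩, ⟨b, z, hb, rfl, hz⟩⟩ := h
  exact congrArg (Quot.mk Γ.Cl.rgen) (quot_mk_eq_of_rel Γ.R hb.symm hy hz)

theorem BRel.clToCrCl_eq (Γ : BRel) (α β : Γ.Cl.S) (h : Γ.Cl.rgen α β) :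
    Γ.clToCrCl α = Γ.clToCrCl β := by
  obtain ⟨ξ, ⟨y, a, rfl, rfl, hy⟩, ⟨z, b, rfl, hb, hz⟩⟩ := h
  exact congrArg (Quot.mk Γ.Cr.lgen) (quot_mk_eq_of_rel (flip Γ.R) hb.symm hy hz)

/-- The two iterated contractions have the same vertex set, as quotients of `S`. -/
def BRel.crClEquiv (Γ : BRel) : Γ.Cr.Cl.S ≃ Γ.Cl.Cr.S where
  toFun := Quot.lift Γ.crToClCr Γ.crToClCr_eq
  invFun := Quot.lift Γ.clToCrCl Γ.clToCrCl_eq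
  left_inv := by
    rintro ⟨⟨a⟩⟩
    rfl
  right_inv := by
    rintro ⟨⟨a⟩⟩
    rfl

theorem BRel.crCl_rel_iff (Γ : BRel) (x y : Γ.Cr.Cl.S) :
    Γ.Cr.Cl.R x y ↔ ∃ a b, Quot.mk Γ.Cr.lgen (Quot.mk Γ.rgen a) = x ∧
      Quot.mk Γ.Cr.lgen (Quot.mk Γ.rgen b) = y ∧ Γ.R a b := by
  constructor
  · rintro ⟨_, _, rfl, rfl, a, b, rfl, rfl, h⟩
    exact ⟨a, b, rfl, rfl, h⟩
  · rintro ⟨a, b, rfl, rfl, h⟩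
    exact ⟨_, _, rfl, rfl, a, b, rfl, rfl, h⟩

theorem BRel.clCr_rel_iff (Γ : BRel) (x y : Γ.Cl.Cr.S) :
    Γ.Cl.Cr.R x y ↔ ∃ a b, Quot.mk Γ.Cl.rgen (Quot.mk Γ.lgen a) = x ∧
      Quot.mk Γ.Cl.rgen (Quot.mk Γ.lgen b) = y ∧ Γ.R a b := by
  constructor
  · rintro ⟨_, _, rfl, rfl, a, b, rfl, rfl, h⟩
    exact ⟨a, b, rfl, rfl, h⟩
  · rintro ⟨a, b, rfl, rfl, h⟩
    exact ⟨_, _, rfl, rfl, a, b, rfl, rfl, h⟩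

/-- `C_l(C_r Γ)` and `C_r(C_l Γ)` determine the same partition of `S`
and the induced relations coincide; in particular they are graph-isomorphic. -/
theorem stmt1 (Γ : BRel) :
    ∃ φ : (Γ.Cr.Cl).S ≃ (Γ.Cl.Cr).S,
      (∀ a : Γ.S,
        φ (Quot.mk Γ.Cr.lgen (Quot.mk Γ.rgen a)) = Quot.mk Γ.Cl.rgen (Quot.mk Γ.lgen a)) ∧
      ∀ x y, (Γ.Cl.Cr).R (φ x) (φ y) ↔ (Γ.Cr.Cl).R x y := by
  refine ⟨Γ.crClEquiv, fun _ => rfl, fun x y => ?_⟩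
  rw [Γ.crCl_rel_iff, Γ.clCr_rel_iff]
  refine exists_congr fun a => exists_congr fun b => and_congr ?_ (and_congr ?_ Iff.rfl)
  · exact Γ.crClEquiv.apply_eq_iff_eq (x := Quot.mk _ (Quot.mk _ a))
  · exact Γ.crClEquiv.apply_eq_iff_eq (x := Quot.mk _ (Quot.mk _ b))

end Towber
end

section
/- Let Γ = (R,S) be a finite binary relation and let C^{∞,∞}Γ be its C-stabilization. Then C^{∞,∞}Γ is, in a unique way (up to the ordering of the pieces), the disjoint union of finitely many sub-relations each of which is either of type C_N for some N ≥ 1 (an N-cycle: vertices v_1,…,v_N with edges (v_1,v_2),…,(v_{N−1},v_N),(v_N,v_1)) or of type L_N for some N ≥ 1 (a path: vertices v_1,…,v_N with edges (v_1,v_2),…,(v_{N−1},v_N)). Equivalently, in C^{∞,∞}Γ every vertex has at most one successor and at most one predecessor. -/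
open Polynomial

namespace Towber

variable (K : Type) [Field K]

theorem BRel.Iso.symm {Γ Δ : BRel} (h : Γ.Iso Δ) : Δ.Iso Γ := by
  obtain ⟨φ, h⟩ := h
  exact ⟨φ.symm, fun a b => by simpa using (h (φ.symm a) (φ.symm b)).symm⟩

theorem BRel.Iso.trans {Γ Δ Θ : BRel} (h : Γ.Iso Δ) (h' : Δ.Iso Θ) : Γ.Iso Θ := by
  obtain ⟨φ, h⟩ := h
  obtain ⟨ψ, h'⟩ := h'
  exact ⟨φ.trans ψ, fun a b => (h' _ _).trans (h a b)⟩

/-- An isomorphism compatible with the generating relations descends to quotients. -/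
theorem BRel.Iso.quotBy {Γ Δ : BRel} (φ : Γ.S ≃ Δ.S) (h : ∀ a b, Δ.R (φ a) (φ b) ↔ Γ.R a b)
    {r : Γ.S → Γ.S → Prop} {s : Δ.S → Δ.S → Prop} (hrs : ∀ a b, r a b ↔ s (φ a) (φ b)) :
    (Γ.quotBy r).Iso (Δ.quotBy s) := by
  refine ⟨Quot.congr φ hrs, fun α β => ?_⟩
  constructor
  · rintro ⟨a, b, ha, hb, hab⟩
    refine ⟨φ.symm a, φ.symm b, ?_, ?_, ?_⟩
    · apply (Quot.congr φ hrs).injective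
      exact (congrArg (Quot.mk s) (φ.apply_symm_apply a)).trans ha
    · apply (Quot.congr φ hrs).injective
      exact (congrArg (Quot.mk s) (φ.apply_symm_apply b)).trans hb
    · rw [← h]
      simpa using hab
  · rintro ⟨a, b, rfl, rfl, hab⟩
    exact ⟨φ a, φ b, rfl, rfl, (h a b).2 hab⟩

theorem BRel.Iso.Cl {Γ Δ : BRel} (h : Γ.Iso Δ) : Γ.Cl.Iso Δ.Cl := by
  obtain ⟨φ, h⟩ := h
  refine BRel.Iso.quotBy φ h fun a b => ?_
  rw [BRel.lgen, BRel.lgen, ← φ.exists_congr_right]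
  simp only [h]

theorem BRel.Iso.iterate_Cl {Γ Δ : BRel} (h : Γ.Iso Δ) (n : ℕ) :
    (BRel.Cl^[n] Γ).Iso (BRel.Cl^[n] Δ) := by
  induction n with
  | zero => exact h
  | succ n ih =>
    rw [Function.iterate_succ_apply', Function.iterate_succ_apply']
    exact ih.Cl

/-- Predecessors of left-equivalent vertices are right-equivalent. -/
theorem BRel.mk_rgen_eq_of_mk_lgen_eq (Γ : BRel) {a a' b b' : Γ.S}
    (hb : Quot.mk Γ.lgen b = Quot.mk Γ.lgen b') (h : Γ.R a b) (h' : Γ.R a' b') :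
    Quot.mk Γ.rgen a = Quot.mk Γ.rgen a' := by
  let P : Γ.S → Set (Quot Γ.rgen) := fun y => {ξ | ∃ x, Quot.mk Γ.rgen x = ξ ∧ Γ.R x y}
  have hP : ∀ y y', Γ.lgen y y' → P y = P y' := by
    rintro y y' ⟨x, hy, hy'⟩
    ext ξ
    constructor
    · rintro ⟨z, rfl, hz⟩
      exact ⟨x, Quot.sound ⟨y, hy, hz⟩, hy'⟩
    · rintro ⟨z, rfl, hz⟩
      exact ⟨x, Quot.sound ⟨y', hy', hz⟩, hy⟩
  have hPb : P b = P b' := congrArg (Quot.lift P hP) hb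
  have ha : Quot.mk Γ.rgen a ∈ P b' := hPb ▸ ⟨a, rfl, h⟩
  obtain ⟨z, hz, hzb⟩ := ha
  rw [← hz]
  exact Quot.sound ⟨b', hzb, h'⟩

/-- Successors of right-equivalent vertices are left-equivalent. -/
theorem BRel.mk_lgen_eq_of_mk_rgen_eq (Γ : BRel) {a a' b b' : Γ.S}
    (ha : Quot.mk Γ.rgen a = Quot.mk Γ.rgen a') (h : Γ.R a b) (h' : Γ.R a' b') :
    Quot.mk Γ.lgen b = Quot.mk Γ.lgen b' :=
  BRel.mk_rgen_eq_of_mk_lgen_eq ⟨Γ.S, fun x y => Γ.R y x⟩ ha h h'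

/-- Left and right contraction commute. -/
theorem BRel.Cr_Cl_iso (Γ : BRel) : Γ.Cl.Cr.Iso Γ.Cr.Cl := by
  let q : Γ.S → Γ.Cl.Cr.S := fun a => Quot.mk Γ.Cl.rgen (Quot.mk Γ.lgen a)
  let q' : Γ.S → Γ.Cr.Cl.S := fun a => Quot.mk Γ.Cr.lgen (Quot.mk Γ.rgen a)
  let f : Γ.Cl.Cr.S → Γ.Cr.Cl.S := Quot.lift
    (Quot.lift q' (by
      rintro a a' ⟨x, h, h'⟩
      exact Quot.sound ⟨Quot.mk _ x, ⟨x, a, rfl, rfl, h⟩, ⟨x, a', rfl, rfl, h'⟩⟩))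
    (by
      rintro _ _ ⟨_, ⟨a, b, rfl, rfl, h⟩, ⟨a', b', rfl, hb, h'⟩⟩
      exact congrArg (Quot.mk Γ.Cr.lgen) (Γ.mk_rgen_eq_of_mk_lgen_eq hb.symm h h'))
  let f' : Γ.Cr.Cl.S → Γ.Cl.Cr.S := Quot.lift
    (Quot.lift q (by
      rintro a a' ⟨x, h, h'⟩
      exact Quot.sound ⟨Quot.mk _ x, ⟨a, x, rfl, rfl, h⟩, ⟨a', x, rfl, rfl, h'⟩⟩))
    (by
      rintro _ _ ⟨_, ⟨a, b, rfl, rfl, h⟩, ⟨a', b', ha, rfl, h'⟩⟩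
      exact congrArg (Quot.mk Γ.Cl.rgen) (Γ.mk_lgen_eq_of_mk_rgen_eq ha.symm h h'))
  have hf : ∀ ξ, f' (f ξ) = ξ := by
    rintro ⟨⟨a⟩⟩
    rfl
  have hf' : ∀ ξ, f (f' ξ) = ξ := by
    rintro ⟨⟨a⟩⟩
    rfl
  refine ⟨⟨f, f', hf, hf'⟩, fun α β => ?_⟩
  constructor
  · rintro ⟨_, _, hα, hβ, a, b, rfl, rfl, h⟩
    refine ⟨Quot.mk _ a, Quot.mk _ b, ?_, ?_, a, b, rfl, rfl, h⟩
    · exact (congrArg f' hα).trans (hf α)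
    · exact (congrArg f' hβ).trans (hf β)
  · rintro ⟨_, _, rfl, rfl, a, b, rfl, rfl, h⟩
    exact ⟨Quot.mk _ a, Quot.mk _ b, rfl, rfl, a, b, rfl, rfl, h⟩

theorem BRel.Cr_iterate_Cl_iso (Γ : BRel) (n : ℕ) :
    (BRel.Cl^[n] Γ).Cr.Iso (BRel.Cl^[n] Γ.Cr) := by
  induction n generalizing Γ with
  | zero => exact ⟨Equiv.refl _, fun _ _ => Iff.rfl⟩
  | succ n ih => exact (ih Γ.Cl).trans (Γ.Cr_Cl_iso.iterate_Cl n)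

/-- A quotient of a finite type with as many elements as the type identifies nothing. -/
theorem eq_of_quot_equiv {S : Type} [Finite S] {r : S → S → Prop} (e : Quot r ≃ S) {a b : S}
    (h : r a b) : a = b := by
  have hs : Function.Surjective (e ∘ Quot.mk r) := e.surjective.comp Quot.mk_surjective
  exact Finite.injective_iff_surjective.2 hs (congrArg e (Quot.sound h))

theorem BRel.eq_of_Cl_iso {Γ : BRel} (h : Γ.Cl.Iso Γ) {a b b' : Γ.S} (hb : Γ.R a b)
    (hb' : Γ.R a b') : b = b' := by
  obtain ⟨e, -⟩ := h
  exact eq_of_quot_equiv (r := Γ.lgen) e ⟨a, hb, hb'⟩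

theorem BRel.eq_of_Cr_iso {Γ : BRel} (h : Γ.Cr.Iso Γ) {a a' b : Γ.S} (ha : Γ.R a b)
    (ha' : Γ.R a' b) : a = a' := by
  obtain ⟨e, -⟩ := h
  exact eq_of_quot_equiv (r := Γ.rgen) e ⟨b, ha, ha'⟩

theorem modelGraph_R_inl {p q : ℕ} {m : Fin p → ℕ} {c : Fin q → ℕ} (i : Fin p) (a : Fin (m i))
    (y : (Σ i, Fin (m i)) ⊕ (Σ j, Fin (c j))) :
    (modelGraph p q m c).R (Sum.inl ⟨i, a⟩) y ↔
      ∃ b : Fin (m i), y = Sum.inl ⟨i, b⟩ ∧ (b : ℕ) = a + 1 := by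
  constructor
  · rintro (⟨i', a', b, h, rfl, hb⟩ | ⟨j, a', b, h, rfl, hb⟩)
    · cases h
      exact ⟨b, rfl, hb⟩
    · cases h
  · rintro ⟨b, rfl, hb⟩
    exact Or.inl ⟨i, a, b, rfl, rfl, hb⟩

theorem modelGraph_R_inr {p q : ℕ} {m : Fin p → ℕ} {c : Fin q → ℕ} (j : Fin q) (a : Fin (c j))
    (y : (Σ i, Fin (m i)) ⊕ (Σ j, Fin (c j))) :
    (modelGraph p q m c).R (Sum.inr ⟨j, a⟩) y ↔
      ∃ b : Fin (c j), y = Sum.inr ⟨j, b⟩ ∧ (b : ℕ) = (a + 1) % c j := by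
  constructor
  · rintro (⟨i', a', b, h, rfl, hb⟩ | ⟨j, a', b, h, rfl, hb⟩)
    · cases h
    · cases h
      exact ⟨b, rfl, hb⟩
  · rintro ⟨b, rfl, hb⟩
    exact Or.inr ⟨j, a, b, rfl, rfl, hb⟩

/-- Every vertex on a cycle has a predecessor. -/
theorem modelGraph_exists_pred_inr {p q : ℕ} {m : Fin p → ℕ} {c : Fin q → ℕ}
    (y : Σ j, Fin (c j)) : ∃ x, (modelGraph p q m c).R x (Sum.inr y) := by
  obtain ⟨j, ⟨b, hb⟩⟩ := y
  rcases b with _ | b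
  · exact ⟨Sum.inr ⟨j, ⟨c j - 1, by omega⟩⟩, Or.inr ⟨j, _, _, rfl, rfl, by
      simp [Nat.sub_add_cancel (show 1 ≤ c j from hb)]⟩⟩
  · exact ⟨Sum.inr ⟨j, ⟨b, by omega⟩⟩, Or.inr ⟨j, _, _, rfl, rfl, by
      simp [Nat.mod_eq_of_lt hb]⟩⟩

/-- An isomorphism of models maps each path into a single path. -/
theorem exists_map_path {p q p' q' : ℕ} {m : Fin p → ℕ} {c : Fin q → ℕ} {m' : Fin p' → ℕ}
    {c' : Fin q' → ℕ} (hm : ∀ i, 1 ≤ m i)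
    (ψ : ((Σ i, Fin (m i)) ⊕ (Σ j, Fin (c j))) ≃ ((Σ i, Fin (m' i)) ⊕ (Σ j, Fin (c' j))))
    (hψ : ∀ x y, (modelGraph p' q' m' c').R (ψ x) (ψ y) ↔ (modelGraph p q m c).R x y)
    (i : Fin p) : ∃ i', ∀ a, ∃ b, ψ (Sum.inl ⟨i, a⟩) = Sum.inl ⟨i', b⟩ := by
  obtain ⟨i', b₀, h₀⟩ : ∃ i' b, ψ (Sum.inl ⟨i, ⟨0, hm i⟩⟩) = Sum.inl ⟨i', b⟩ := by
    rcases hy : ψ (Sum.inl ⟨i, ⟨0, hm i⟩⟩) with ⟨i', b⟩ | y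
    · exact ⟨i', b, rfl⟩
    · exfalso
      obtain ⟨x, hx⟩ := modelGraph_exists_pred_inr (m := m') y
      rw [← hy] at hx
      obtain ⟨x, rfl⟩ := ψ.surjective x
      rw [hψ] at hx
      rcases x with ⟨k, a⟩ | ⟨k, a⟩
      · obtain ⟨b, h, hb⟩ := (modelGraph_R_inl _ _ _).1 hx
        cases h
        simp at hb
      · obtain ⟨b, h, hb⟩ := (modelGraph_R_inr _ _ _).1 hx
        cases h
  refine ⟨i', ?_⟩
  rintro ⟨a, ha⟩
  induction a with
  | zero => exact ⟨b₀, h₀⟩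
  | succ a ih =>
    obtain ⟨b, hb⟩ := ih (by omega)
    have hR : (modelGraph p q m c).R (Sum.inl ⟨i, ⟨a, by omega⟩⟩) (Sum.inl ⟨i, ⟨a + 1, ha⟩⟩) :=
      (modelGraph_R_inl _ _ _).2 ⟨_, rfl, rfl⟩
    rw [← hψ, hb, modelGraph_R_inl] at hR
    obtain ⟨b', hb', -⟩ := hR
    exact ⟨b', hb'⟩

/-- An isomorphism of models maps each cycle into a single cycle. -/
theorem exists_map_cycle {p q p' q' : ℕ} {m : Fin p → ℕ} {c : Fin q → ℕ} {m' : Fin p' → ℕ}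
    {c' : Fin q' → ℕ} (hm' : ∀ i, 1 ≤ m' i) (hc : ∀ j, 1 ≤ c j)
    (ψ : ((Σ i, Fin (m i)) ⊕ (Σ j, Fin (c j))) ≃ ((Σ i, Fin (m' i)) ⊕ (Σ j, Fin (c' j))))
    (hψ : ∀ x y, (modelGraph p' q' m' c').R (ψ x) (ψ y) ↔ (modelGraph p q m c).R x y)
    (j : Fin q) : ∃ j', ∀ a, ∃ b, ψ (Sum.inr ⟨j, a⟩) = Sum.inr ⟨j', b⟩ := by
  obtain ⟨j', b₀, h₀⟩ : ∃ j' b, ψ (Sum.inr ⟨j, ⟨0, hc j⟩⟩) = Sum.inr ⟨j', b⟩ := by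
    rcases hy : ψ (Sum.inr ⟨j, ⟨0, hc j⟩⟩) with ⟨i', b⟩ | ⟨j', b⟩
    · exfalso
      obtain ⟨i, h⟩ := exists_map_path hm' ψ.symm
        (fun x y => by simpa using (hψ (ψ.symm x) (ψ.symm y)).symm) i'
      obtain ⟨a, ha⟩ := h b
      rw [← hy, Equiv.symm_apply_apply] at ha
      cases ha
    · exact ⟨j', b, rfl⟩
  refine ⟨j', ?_⟩
  rintro ⟨a, ha⟩
  induction a with
  | zero => exact ⟨b₀, h₀⟩
  | succ a ih =>
    obtain ⟨b, hb⟩ := ih (by omega)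
    have hR : (modelGraph p q m c).R (Sum.inr ⟨j, ⟨a, by omega⟩⟩) (Sum.inr ⟨j, ⟨a + 1, ha⟩⟩) :=
      (modelGraph_R_inr _ _ _).2 ⟨_, rfl, (Nat.mod_eq_of_lt ha).symm⟩
    rw [← hψ, hb, modelGraph_R_inr] at hR
    obtain ⟨b', hb', -⟩ := hR
    exact ⟨b', hb'⟩

/-- Mutually inverse maps of disjoint unions respecting the summands match summands of equal
size. -/
theorem exists_equiv_of_fiberwise {I I' : Type} {m : I → ℕ} {m' : I' → ℕ} (hm : ∀ i, 1 ≤ m i)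
    (hm' : ∀ i, 1 ≤ m' i) (F : ∀ i, Fin (m i) → Σ i, Fin (m' i))
    (G : ∀ i, Fin (m' i) → Σ i, Fin (m i)) (σ : I → I') (τ : I' → I)
    (hF : ∀ i a, (F i a).1 = σ i) (hG : ∀ i a, (G i a).1 = τ i)
    (hGF : ∀ i a, G _ (F i a).2 = ⟨i, a⟩) (hFG : ∀ i a, F _ (G i a).2 = ⟨i, a⟩) :
    ∃ e : I ≃ I', ∀ i, m' (e i) = m i := by
  have hτσ : ∀ i, τ (σ i) = i := fun i => by
    rw [← hF i ⟨0, hm i⟩, ← hG _ (F i ⟨0, hm i⟩).2, hGF]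
  have hστ : ∀ i, σ (τ i) = i := fun i => by
    rw [← hG i ⟨0, hm' i⟩, ← hF _ (G i ⟨0, hm' i⟩).2, hFG]
  have le : ∀ i, m i ≤ m' (σ i) := fun i => by
    have hinj : Function.Injective fun a => Fin.cast (congrArg m' (hF i a)) (F i a).2 := by
      intro a b hab
      have h2 : F i a = F i b := by
        refine Sigma.ext ((hF i a).trans (hF i b).symm) ?_
        rw [Fin.heq_ext_iff (by rw [hF, hF])]
        simpa [Fin.ext_iff] using hab
      have h3 := hGF i a
      rw [h2, hGF] at h3
      cases h3
      rfl
    simpa using Fintype.card_le_of_injective _ hinj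
  have le' : ∀ i, m' i ≤ m (τ i) := fun i => by
    have hinj : Function.Injective fun a => Fin.cast (congrArg m (hG i a)) (G i a).2 := by
      intro a b hab
      have h2 : G i a = G i b := by
        refine Sigma.ext ((hG i a).trans (hG i b).symm) ?_
        rw [Fin.heq_ext_iff (by rw [hG, hG])]
        simpa [Fin.ext_iff] using hab
      have h3 := hFG i a
      rw [h2, hFG] at h3
      cases h3
      rfl
    simpa using Fintype.card_le_of_injective _ hinj
  refine ⟨⟨σ, τ, hτσ, hστ⟩, fun i => le_antisymm ?_ (le i)⟩
  simpa [hτσ] using le' (σ i)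

/-- Isomorphic models have the same path and cycle lengths, up to order. -/
theorem exists_equiv_of_modelGraph_iso {p q p' q' : ℕ} {m : Fin p → ℕ} {c : Fin q → ℕ}
    {m' : Fin p' → ℕ} {c' : Fin q' → ℕ} (hm : ∀ i, 1 ≤ m i) (hc : ∀ j, 1 ≤ c j)
    (hm' : ∀ i, 1 ≤ m' i) (hc' : ∀ j, 1 ≤ c' j)
    (h : (modelGraph p q m c).Iso (modelGraph p' q' m' c')) :
    ∃ (σ : Fin p ≃ Fin p') (ρ : Fin q ≃ Fin q'),
      (∀ i, m' (σ i) = m i) ∧ (∀ j, c' (ρ j) = c j) := by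
  obtain ⟨ψ, hψ⟩ := h
  change ((Σ i, Fin (m i)) ⊕ (Σ j, Fin (c j))) ≃ ((Σ i, Fin (m' i)) ⊕ (Σ j, Fin (c' j))) at ψ
  have hψ' : ∀ x y, (modelGraph p q m c).R (ψ.symm x) (ψ.symm y) ↔
      (modelGraph p' q' m' c').R x y :=
    fun x y => (hψ (ψ.symm x) (ψ.symm y)).symm.trans (iff_of_eq (congrArg₂
      (modelGraph p' q' m' c').R (ψ.apply_symm_apply x) (ψ.apply_symm_apply y)))
  choose σ f hf using exists_map_path hm ψ hψ
  choose τ g hg using exists_map_path hm' ψ.symm hψ'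
  choose ρ u hu using exists_map_cycle hm' hc ψ hψ
  choose κ v hv using exists_map_cycle hm hc' ψ.symm hψ'
  obtain ⟨e, he⟩ := exists_equiv_of_fiberwise hm hm' (fun i a => ⟨σ i, f i a⟩)
    (fun i a => ⟨τ i, g i a⟩) σ τ (fun _ _ => rfl) (fun _ _ => rfl)
    (fun i a => Sum.inl_injective (by rw [← hg, ← hf, Equiv.symm_apply_apply]))
    (fun i a => Sum.inl_injective (by rw [← hf, ← hg, Equiv.apply_symm_apply]))
  obtain ⟨d, hd⟩ := exists_equiv_of_fiberwise hc hc' (fun i a => ⟨ρ i, u i a⟩)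
    (fun i a => ⟨κ i, v i a⟩) ρ κ (fun _ _ => rfl) (fun _ _ => rfl)
    (fun i a => Sum.inr_injective (by rw [← hv, ← hu, Equiv.symm_apply_apply]))
    (fun i a => Sum.inr_injective (by rw [← hu, ← hv, Equiv.apply_symm_apply]))
  exact ⟨e, d, he, hd⟩

/-- The graph of a permutation, restricted to the vertices satisfying a predicate, is a disjoint
union of paths and cycles. -/
theorem exists_modelGraph_iso_of_perm {S : Type} [Finite S] (g : Equiv.Perm S) (E : S → Prop) :
    ∃ (p q : ℕ) (m : Fin p → ℕ) (c : Fin q → ℕ), (∀ i, 1 ≤ m i) ∧ (∀ j, 1 ≤ c j) ∧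
      BRel.Iso ⟨S, fun a b => E a ∧ g a = b⟩ (modelGraph p q m c) := by
  classical
  have hper : ∀ x, x ∈ Function.periodicPts g := fun x =>
    g.injective.mem_periodicPts x
  let src := {v : S // ¬ E (g.symm v)}
  let cyc := {ω : Quotient (Equiv.Perm.SameCycle.setoid g) // ∀ x, ⟦x⟧ = ω → E x}
  have hsrc : ∀ v : src, ∃ k, ¬ E (g^[k] v.1) := fun v => by
    obtain ⟨n, hn, hv⟩ := hper v.1
    refine ⟨n - 1, ?_⟩
    have : g^[n - 1] v.1 = g.symm v.1 := by
      rw [Equiv.eq_symm_apply, ← Function.iterate_succ_apply' g, Nat.succ_eq_add_one,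
        Nat.sub_add_cancel hn]
      exact hv
    rw [this]
    exact v.2
  let len : src → ℕ := fun v => Nat.find (hsrc v)
  have hlen : ∀ v k, k < len v → E (g^[k] v.1) := fun v k hk => not_not.1 (Nat.find_min _ hk)
  have hlen' : ∀ v, ¬ E (g^[len v] v.1) := fun v => Nat.find_spec (hsrc v)
  have hmk : ∀ (k : ℕ) (x : S), (⟦g^[k] x⟧ : Quotient (Equiv.Perm.SameCycle.setoid g)) = ⟦x⟧ :=
    fun k x => Quotient.sound (show g.SameCycle _ _ from ⟨-k, by
      rw [Equiv.Perm.iterate_eq_pow, ← Equiv.Perm.mul_apply, ← zpow_natCast, ← zpow_add]; simp⟩)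
  have hcyc : ∀ x y : S, (⟦x⟧ : Quotient (Equiv.Perm.SameCycle.setoid g)) = ⟦y⟧ →
      ∃ k : ℕ, g^[k] x = y := fun x y h => by
    obtain ⟨k, -, hk⟩ := Equiv.Perm.SameCycle.exists_pow_eq' (Quotient.exact h : g.SameCycle x y)
    exact ⟨k, by rw [Equiv.Perm.iterate_eq_pow, hk]⟩
  let per : cyc → ℕ := fun ω => Function.minimalPeriod g ω.1.out
  have hper_pos : ∀ ω, 0 < per ω := fun ω =>
    Function.minimalPeriod_pos_of_mem_periodicPts (hper _)
  obtain ⟨p, ⟨ep⟩⟩ := Finite.exists_equiv_fin src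
  obtain ⟨q, ⟨eq⟩⟩ := Finite.exists_equiv_fin cyc
  let m : Fin p → ℕ := fun i => len (ep.symm i) + 1
  let c : Fin q → ℕ := fun j => per (eq.symm j)
  let Φ : ((Σ i, Fin (m i)) ⊕ (Σ j, Fin (c j))) → S :=
    Sum.elim (fun x => g^[(x.2 : ℕ)] (ep.symm x.1).1) fun y => g^[(y.2 : ℕ)] (eq.symm y.1).1.out
  have hll_le : ∀ (v w : src) (a b : ℕ), a ≤ b → b ≤ len w → g^[a] v.1 = g^[b] w.1 →
      v = w ∧ a = b := by
    intro v w a b hab hb h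
    obtain ⟨k, rfl⟩ := Nat.exists_eq_add_of_le hab
    rw [Function.iterate_add_apply] at h
    have h := g.injective.iterate a h
    rcases k with _ | k
    · exact ⟨Subtype.ext h, rfl⟩
    · refine absurd (hlen w k (by omega)) ?_
      have : g^[k] w.1 = g.symm v.1 := by
        rw [Equiv.eq_symm_apply, h, Function.iterate_succ_apply']
      rw [this]
      exact v.2
  have hll : ∀ (v w : src) (a b : ℕ), a ≤ len v → b ≤ len w → g^[a] v.1 = g^[b] w.1 →
      v = w ∧ a = b := by
    intro v w a b ha hb h
    rcases le_total a b with hab | hab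
    · exact hll_le v w a b hab hb h
    · obtain ⟨h1, h2⟩ := hll_le w v b a hab ha h.symm
      exact ⟨h1.symm, h2.symm⟩
  have hlr : ∀ (v : src) (ω : cyc) (a b : ℕ), g^[a] v.1 ≠ g^[b] ω.1.out := by
    intro v ω a b h
    refine v.2 (ω.2 _ ?_)
    rw [← hmk 1 (g.symm v.1), Function.iterate_one, Equiv.apply_symm_apply, ← hmk a, h, hmk,
      Quotient.out_eq]
  have hΦi : Function.Injective Φ := by
    rintro (⟨i, a⟩ | ⟨i, a⟩) (⟨j, b⟩ | ⟨j, b⟩) h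
    · obtain ⟨h1, h2⟩ := hll (ep.symm i) (ep.symm j) a b (Nat.le_of_lt_succ a.2)
        (Nat.le_of_lt_succ b.2) h
      obtain rfl := ep.symm.injective h1
      obtain rfl := Fin.ext h2
      rfl
    · exact absurd h (hlr _ _ _ _)
    · exact absurd h.symm (hlr _ _ _ _)
    · have h1 : (eq.symm i).1 = (eq.symm j).1 := by
        rw [← Quotient.out_eq (eq.symm i).1, ← Quotient.out_eq (eq.symm j).1,
          ← hmk a (eq.symm i).1.out, ← hmk b (eq.symm j).1.out]
        exact congrArg _ h
      obtain rfl := eq.symm.injective (Subtype.ext h1)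
      obtain rfl := Fin.ext ((Function.iterate_eq_iterate_iff_of_lt_minimalPeriod a.2 b.2).1 h)
      rfl
  have hΦs : Function.Surjective Φ := by
    intro x
    by_cases hx : ∀ y, (⟦y⟧ : Quotient (Equiv.Perm.SameCycle.setoid g)) = ⟦x⟧ → E y
    · let ω : cyc := ⟨⟦x⟧, hx⟩
      obtain ⟨k, hk⟩ := hcyc ω.1.out x (Quotient.out_eq _)
      refine ⟨Sum.inr ⟨eq ω, ⟨k % per (eq.symm (eq ω)), Nat.mod_lt _ (hper_pos _)⟩⟩, ?_⟩
      simp only [Φ, Sum.elim_inr, per, Equiv.symm_apply_apply]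
      rw [Function.iterate_mod_minimalPeriod_eq, hk]
    · push Not at hx
      obtain ⟨y, hy, hEy⟩ := hx
      have hex : ∃ k : ℕ, ∃ v : src, g^[k] v.1 = x := by
        obtain ⟨k, hk⟩ := hcyc (g y) x (by rw [← hy]; exact hmk 1 y)
        exact ⟨k, ⟨g y, by simpa using hEy⟩, hk⟩
      obtain ⟨v, hv⟩ := Nat.find_spec hex
      have hle : Nat.find hex ≤ len v := by
        by_contra! hlt
        refine Nat.find_min hex (m := Nat.find hex - (len v + 1)) (by omega) ?_
        refine ⟨⟨g^[len v + 1] v.1, ?_⟩, ?_⟩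
        · rw [Function.iterate_succ_apply', Equiv.symm_apply_apply]
          exact hlen' v
        · rw [← Function.iterate_add_apply, Nat.sub_add_cancel hlt, hv]
      refine ⟨Sum.inl ⟨ep v, ⟨Nat.find hex, ?_⟩⟩, ?_⟩
      · simp only [m, Equiv.symm_apply_apply]
        omega
      · simpa only [Φ, Sum.elim_inl, Equiv.symm_apply_apply] using hv
  refine ⟨p, q, m, c, fun i => Nat.le_add_left _ _, fun j => hper_pos _, BRel.Iso.symm
    ⟨Equiv.ofBijective Φ ⟨hΦi, hΦs⟩, ?_⟩⟩
  change ∀ x y, (E (Φ x) ∧ g (Φ x) = Φ y) ↔ _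
  rintro (⟨i, a⟩ | ⟨j, a⟩) y
  · rw [modelGraph_R_inl]
    constructor
    · rintro ⟨hE, hy⟩
      have ha : (a : ℕ) ≠ len (ep.symm i) := fun ha => hlen' (ep.symm i) (by rw [← ha]; exact hE)
      have ha' := a.2
      refine ⟨⟨a + 1, by simp only [m] at ha' ⊢; omega⟩, hΦi ?_, rfl⟩
      rw [← hy]
      exact (Function.iterate_succ_apply' g _ _).symm
    · rintro ⟨b, rfl, hb⟩
      refine ⟨hlen _ _ ?_, ?_⟩
      · have hb' : (b : ℕ) < len (ep.symm i) + 1 := b.2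
        change (a : ℕ) < len (ep.symm i)
        omega
      · simp only [Φ, Sum.elim_inl, hb]
        exact (Function.iterate_succ_apply' g _ _).symm
  · rw [modelGraph_R_inr]
    have hE : E (Φ (Sum.inr ⟨j, a⟩)) :=
      (eq.symm j).2 _ ((hmk _ _).trans (Quotient.out_eq _))
    have hnext : ∀ b : Fin (c j), (b : ℕ) = (a + 1) % c j →
        g (Φ (Sum.inr ⟨j, a⟩)) = Φ (Sum.inr ⟨j, b⟩) := by
      intro b hb
      simp only [Φ, Sum.elim_inr, hb, c, per]
      rw [Function.iterate_mod_minimalPeriod_eq, Function.iterate_succ_apply']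
    constructor
    · rintro ⟨-, hy⟩
      refine ⟨⟨(a + 1) % c j, Nat.mod_lt _ (hper_pos _)⟩, hΦi ?_, rfl⟩
      rw [← hy]
      exact hnext _ rfl
    · rintro ⟨b, rfl, hb⟩
      exact ⟨hE, hnext b hb⟩

/-- A finite relation with at most one successor and predecessor per vertex is a disjoint union of
paths and cycles. -/
theorem exists_modelGraph_iso (Γ : BRel) (hs : ∀ a b b', Γ.R a b → Γ.R a b' → b = b')
    (hp : ∀ a a' b, Γ.R a b → Γ.R a' b → a = a') :
    ∃ (p q : ℕ) (m : Fin p → ℕ) (c : Fin q → ℕ), (∀ i, 1 ≤ m i) ∧ (∀ j, 1 ≤ c j) ∧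
      Γ.Iso (modelGraph p q m c) := by
  classical
  let e : {a // ∃ b, Γ.R a b} ≃ {b // ∃ a, Γ.R a b} :=
    { toFun := fun a => ⟨a.2.choose, a.1, a.2.choose_spec⟩
      invFun := fun b => ⟨b.2.choose, b.1, b.2.choose_spec⟩
      left_inv := fun a => Subtype.ext
        (hp _ _ _ (Exists.choose_spec (p := fun x => Γ.R x a.2.choose) _) a.2.choose_spec)
      right_inv := fun b => Subtype.ext
        (hs _ _ _ (Exists.choose_spec (p := fun y => Γ.R b.2.choose y) _) b.2.choose_spec) }
  have hg : ∀ a b, Γ.R a b ↔ (∃ b, Γ.R a b) ∧ e.extendSubtype a = b := by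
    intro a b
    constructor
    · intro h
      refine ⟨⟨b, h⟩, ?_⟩
      rw [e.extendSubtype_apply_of_mem a ⟨b, h⟩]
      exact hs a _ _ (Exists.choose_spec (p := fun b => Γ.R a b) _) h
    · rintro ⟨h, rfl⟩
      rw [e.extendSubtype_apply_of_mem a h]
      exact h.choose_spec
  obtain ⟨p, q, m, c, hm, hc, hiso⟩ :=
    exists_modelGraph_iso_of_perm e.extendSubtype fun a => ∃ b, Γ.R a b
  have hid : Γ.Iso ⟨Γ.S, fun a b => (∃ b, Γ.R a b) ∧ e.extendSubtype a = b⟩ :=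
    ⟨Equiv.refl _, fun a b => (hg a b).symm⟩
  exact ⟨p, q, m, c, hm, hc, hid.trans hiso⟩

/-- The C-stabilization of `Γ` is, uniquely up to reordering of the
pieces, a disjoint union of paths `L_N` and cycles `C_N` (`N ≥ 1`); equivalently, in it
every vertex has at most one successor and at most one predecessor. -/
theorem stmt3 (Γ : BRel) (N : ℕ) (hN : Γ.StabAt N) :
    (∃ (p q : ℕ) (m : Fin p → ℕ) (c : Fin q → ℕ), (∀ i, 1 ≤ m i) ∧ (∀ j, 1 ≤ c j) ∧
        BRel.Iso (BRel.Cl^[N] (BRel.Cr^[N] Γ)) (modelGraph p q m c)) ∧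
    (∀ (p q : ℕ) (m : Fin p → ℕ) (c : Fin q → ℕ)
        (p' q' : ℕ) (m' : Fin p' → ℕ) (c' : Fin q' → ℕ),
        (∀ i, 1 ≤ m i) → (∀ j, 1 ≤ c j) → (∀ i, 1 ≤ m' i) → (∀ j, 1 ≤ c' j) →
        BRel.Iso (BRel.Cl^[N] (BRel.Cr^[N] Γ)) (modelGraph p q m c) →
        BRel.Iso (BRel.Cl^[N] (BRel.Cr^[N] Γ)) (modelGraph p' q' m' c') →
        ∃ (σ : Fin p ≃ Fin p') (ρ : Fin q ≃ Fin q'),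
          (∀ i, m' (σ i) = m i) ∧ (∀ j, c' (ρ j) = c j)) ∧
    (∀ a b b', (BRel.Cl^[N] (BRel.Cr^[N] Γ)).R a b →
        (BRel.Cl^[N] (BRel.Cr^[N] Γ)).R a b' → b = b') ∧
    (∀ a a' b, (BRel.Cl^[N] (BRel.Cr^[N] Γ)).R a b →
        (BRel.Cl^[N] (BRel.Cr^[N] Γ)).R a' b → a = a') := by
  have hl : (BRel.Cl^[N] (BRel.Cr^[N] Γ)).Cl.Iso (BRel.Cl^[N] (BRel.Cr^[N] Γ)) := by
    rw [← Function.iterate_succ_apply' BRel.Cl]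
    exact hN (N + 1) (Nat.le_succ N) N le_rfl
  have hr : (BRel.Cl^[N] (BRel.Cr^[N] Γ)).Cr.Iso (BRel.Cl^[N] (BRel.Cr^[N] Γ)) := by
    refine (BRel.Cr_iterate_Cl_iso _ N).trans ?_
    rw [← Function.iterate_succ_apply' BRel.Cr]
    exact hN N le_rfl (N + 1) (Nat.le_succ N)
  have hs : ∀ a b b', (BRel.Cl^[N] (BRel.Cr^[N] Γ)).R a b →
      (BRel.Cl^[N] (BRel.Cr^[N] Γ)).R a b' → b = b' := fun _ _ _ => BRel.eq_of_Cl_iso hl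
  have hp : ∀ a a' b, (BRel.Cl^[N] (BRel.Cr^[N] Γ)).R a b →
      (BRel.Cl^[N] (BRel.Cr^[N] Γ)).R a' b → a = a' := fun _ _ _ => BRel.eq_of_Cr_iso hr
  exact ⟨exists_modelGraph_iso _ hs hp,
    fun _ _ _ _ _ _ _ _ hm hc hm' hc' h h' =>
      exists_equiv_of_modelGraph_iso hm hc hm' hc' (h.symm.trans h'), hs, hp⟩

end Towber
end

section
/- Let K be a field, let Γ = (R,S) be a finite binary relation, and suppose the K-linearization K(Γ) is isomorphic to a finite direct sum of members of Kronecker's list L(K). Then for every p ≥ 0, the number of summands isomorphic to ^0T^0_{2p+1} in this decomposition equals γ_{p,p}(Γ) − γ_{p,p+1}(Γ) − γ_{p+1,p}(Γ) + γ_{p+1,p+1}(Γ). -/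
open Polynomial

namespace Towber

variable (K : Type) [Field K]

section Filtration

variable {K}

/-- The pullback of left contraction to submodules of the target space. -/
def Pair.lstep (τ : Pair K) (U : Submodule K τ.V) : Submodule K τ.V :=
  U ⊔ (U.comap τ.mu).map τ.nu

/-- The pullback of right contraction to submodules of the target space. -/
def Pair.rstep (τ : Pair K) (U : Submodule K τ.V) : Submodule K τ.V :=
  U ⊔ (U.comap τ.nu).map τ.mu

/-- The submodule killed by `m` left and `n` right contractions. -/
def Pair.filt (τ : Pair K) (m n : ℕ) : Submodule K τ.V :=
  τ.lstep^[m] (τ.rstep^[n] ⊥)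

/-- The codimension of `Pair.filt`. -/
noncomputable def Pair.codim (τ : Pair K) (m n : ℕ) : ℕ :=
  Module.finrank K (τ.V ⧸ τ.filt m n)

/-- The mixed second difference of the codimensions at `(p, p)`. -/
noncomputable def Pair.delta (τ : Pair K) (p : ℕ) : ℤ :=
  (τ.codim p p : ℤ) - τ.codim p (p + 1) - τ.codim (p + 1) p + τ.codim (p + 1) (p + 1)

theorem Pair.lstep_rstep (τ : Pair K) (U : Submodule K τ.V) :
    τ.lstep (τ.rstep U) = τ.rstep (τ.lstep U) := by
  have key : ∀ f g : τ.E →ₗ[K] τ.V,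
      (U ⊔ (U.comap g).map f) ⊔ ((U ⊔ (U.comap g).map f).comap f).map g =
        U ⊔ (U.comap g).map f ⊔ (U.comap f).map g := by
    intro f g
    apply le_antisymm
    · refine sup_le le_sup_left ?_
      rintro _ ⟨e, he, rfl⟩
      obtain ⟨u, hu, _, ⟨e', he', rfl⟩, h⟩ := Submodule.mem_sup.1 he
      have h1 : e - e' ∈ U.comap f := by
        rw [Submodule.mem_comap, map_sub, ← h, add_sub_cancel_right]
        exact hu
      have h2 : g e = g (e - e') + g e' := by simp
      rw [h2]
      exact add_mem (Submodule.mem_sup_right (Submodule.mem_map_of_mem h1))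
        (Submodule.mem_sup_left (Submodule.mem_sup_left he'))
    · exact sup_le_sup_left (Submodule.map_mono (Submodule.comap_mono le_sup_left)) _
  unfold Pair.lstep Pair.rstep
  rw [key τ.mu τ.nu, key τ.nu τ.mu, sup_assoc, sup_assoc,
    sup_comm ((U.comap τ.nu).map τ.mu)]

theorem Pair.delta_of_nu_injective (τ : Pair K) (h : Function.Injective τ.nu) (p : ℕ) :
    τ.delta p = 0 := by
  have h0 : τ.rstep ⊥ = ⊥ := by
    simp [Pair.rstep, LinearMap.ker_eq_bot.2 h]
  have hc : ∀ m n n', τ.codim m n = τ.codim m n' := fun m n n' => by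
    rw [Pair.codim, Pair.codim, Pair.filt, Pair.filt, Function.iterate_fixed h0,
      Function.iterate_fixed h0]
  rw [Pair.delta, hc p p (p + 1), hc (p + 1) p (p + 1)]
  ring

theorem Pair.delta_of_mu_injective (τ : Pair K) (h : Function.Injective τ.mu) (p : ℕ) :
    τ.delta p = 0 := by
  have h0 : τ.lstep ⊥ = ⊥ := by
    simp [Pair.lstep, LinearMap.ker_eq_bot.2 h]
  have hf : ∀ m n, τ.filt m n = τ.rstep^[n] ⊥ := fun m n => by
    have hc : Function.Commute τ.lstep τ.rstep := τ.lstep_rstep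
    rw [Pair.filt, (hc.iterate_iterate m n).eq, Function.iterate_fixed h0]
  have hc : ∀ m m' n, τ.codim m n = τ.codim m' n := fun m m' n => by
    rw [Pair.codim, Pair.codim, hf, hf]
  rw [Pair.delta, hc p (p + 1) p, hc p (p + 1) (p + 1)]
  ring

theorem sup_map_comap_equiv {E E' V V' : Type} [AddCommGroup E] [Module K E] [AddCommGroup V]
    [Module K V] [AddCommGroup E'] [Module K E'] [AddCommGroup V'] [Module K V']
    {f g : E →ₗ[K] V} {f' g' : E' →ₗ[K] V'} (α : E ≃ₗ[K] E') (β : V ≃ₗ[K] V')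
    (hf : ∀ x, f' (α x) = β (f x)) (hg : ∀ x, g' (α x) = β (g x)) (U : Submodule K V) :
    U.map β.toLinearMap ⊔ ((U.map β.toLinearMap).comap f').map g' =
      (U ⊔ (U.comap f).map g).map β.toLinearMap := by
  rw [Submodule.map_sup]
  congr 1
  ext v
  constructor
  · rintro ⟨e, he, rfl⟩
    obtain ⟨e, rfl⟩ := α.surjective e
    obtain ⟨u, hu, h⟩ := he
    have h : β u = f' (α e) := h
    rw [hf] at h
    refine ⟨g e, ⟨e, ?_, rfl⟩, (hg e).symm⟩
    rw [β.injective h] at hu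
    exact hu
  · rintro ⟨_, ⟨e, he, rfl⟩, rfl⟩
    exact ⟨α e, ⟨f e, he, (hf e).symm⟩, hg e⟩

theorem Pair.Iso.codim_eq {τ σ : Pair K} (h : Pair.Iso K τ σ) (m n : ℕ) :
    τ.codim m n = σ.codim m n := by
  obtain ⟨α, β, hm, hn⟩ := h
  have hl : Function.Semiconj (Submodule.map β.toLinearMap) τ.lstep σ.lstep := fun U =>
    (sup_map_comap_equiv α β hm hn U).symm
  have hr : Function.Semiconj (Submodule.map β.toLinearMap) τ.rstep σ.rstep := fun U =>
    (sup_map_comap_equiv α β hn hm U).symm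
  have key : (τ.filt m n).map β.toLinearMap = σ.filt m n := by
    rw [Pair.filt, (hl.iterate_right m).eq, (hr.iterate_right n).eq, Submodule.map_bot]
    rfl
  exact LinearEquiv.finrank_eq (Submodule.Quotient.equiv _ _ β key)

theorem Pair.Iso.delta_eq {τ σ : Pair K} (h : Pair.Iso K τ σ) (p : ℕ) :
    τ.delta p = σ.delta p := by
  simp only [Pair.delta, h.codim_eq]

theorem sup_map_comap_pi {ι : Type} {E V : ι → Type} [∀ i, AddCommGroup (E i)]
    [∀ i, Module K (E i)] [∀ i, AddCommGroup (V i)] [∀ i, Module K (V i)]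
    (f g : ∀ i, E i →ₗ[K] V i) (U : ∀ i, Submodule K (V i)) :
    Submodule.pi Set.univ (fun i => U i ⊔ ((U i).comap (f i)).map (g i)) =
      Submodule.pi Set.univ U ⊔
        ((Submodule.pi Set.univ U).comap (LinearMap.pi fun i => f i ∘ₗ LinearMap.proj i)).map
          (LinearMap.pi fun i => g i ∘ₗ LinearMap.proj i) := by
  apply le_antisymm
  · intro v hv
    have hv' : ∀ i, ∃ u ∈ U i, ∃ e, f i e ∈ U i ∧ u + g i e = v i := by
      intro i
      obtain ⟨u, hu, _, ⟨e, he, rfl⟩, h⟩ := Submodule.mem_sup.1 (hv i trivial)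
      exact ⟨u, hu, e, he, h⟩
    choose u hu e he h using hv'
    exact Submodule.mem_sup.2
      ⟨u, fun i _ => hu i, _, ⟨e, fun i _ => he i, rfl⟩, funext h⟩
  · refine sup_le (fun v hv i hi => Submodule.mem_sup_left (hv i hi)) ?_
    rintro _ ⟨e, he, rfl⟩ i hi
    exact Submodule.mem_sup_right ⟨e i, he i hi, rfl⟩

theorem dSum_codim {k : ℕ} (τ : Fin k → Pair K) (m n : ℕ) :
    (dSum K (Fin k) τ).codim m n = ∑ i, (τ i).codim m n := by
  have hr : ∀ n, (dSum K (Fin k) τ).rstep^[n] ⊥ =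
      Submodule.pi Set.univ fun i => (τ i).rstep^[n] ⊥ := by
    intro n
    induction n with
    | zero =>
      ext v
      simp only [Function.iterate_zero, id]
      exact (Submodule.mem_bot K).trans
        ⟨fun h i _ => congrFun h i, fun h => funext fun i => h i trivial⟩
    | succ n ih =>
      simp only [Function.iterate_succ_apply']
      rw [ih]
      exact (sup_map_comap_pi (fun i => (τ i).nu) (fun i => (τ i).mu) _).symm
  have hl : ∀ m, (dSum K (Fin k) τ).filt m n =
      Submodule.pi Set.univ fun i => (τ i).filt m n := by
    intro m
    induction m with
    | zero => exact hr n
    | succ m ih =>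
      simp only [Pair.filt, Function.iterate_succ_apply'] at ih ⊢
      rw [ih]
      exact (sup_map_comap_pi (fun i => (τ i).mu) (fun i => (τ i).nu) _).symm
  unfold Pair.codim
  rw [hl]
  exact (LinearEquiv.finrank_eq (Submodule.quotientPi fun i => (τ i).filt m n)).trans
    (Module.finrank_pi_fintype K)

theorem dSum_delta {k : ℕ} (τ : Fin k → Pair K) (p : ℕ) :
    (dSum K (Fin k) τ).delta p = ∑ i, (τ i).delta p := by
  simp only [Pair.delta, dSum_codim, Finset.sum_add_distrib, Finset.sum_sub_distrib]
  push_cast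
  rfl

end Filtration

section KroneckerList

variable {K}

/-- Vectors whose coordinates vanish outside of the first `b` and the last `a` ones. -/
def outerCoords (N a b : ℕ) : Submodule K (Fin N → K) where
  carrier := {v | ∀ i : Fin N, b ≤ i → i + a < N → v i = 0}
  add_mem' hu hv i h h' := by simp [hu i h h', hv i h h']
  zero_mem' _ _ _ := rfl
  smul_mem' c v hv i h h' := by simp [hv i h h']

theorem zTz_mu (N : ℕ) (e : Fin (N + 1) → K) (j : Fin N) :
    (zTz K N).mu e j = e j.castSucc := by
  change Matrix.toLin' _ e j = _
  simp only [Matrix.toLin'_apply, Matrix.mulVec, dotProduct, Matrix.of_apply, ite_mul, one_mul,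
    zero_mul]
  rw [Finset.sum_eq_single j.castSucc] <;> simp +contextual [Fin.ext_iff, eq_comm]

theorem zTz_nu (N : ℕ) (e : Fin (N + 1) → K) (j : Fin N) :
    (zTz K N).nu e j = e j.succ := by
  change Matrix.toLin' _ e j = _
  simp only [Matrix.toLin'_apply, Matrix.mulVec, dotProduct, Matrix.of_apply, ite_mul, one_mul,
    zero_mul]
  rw [Finset.sum_eq_single j.succ] <;> simp +contextual [Fin.ext_iff, eq_comm]

theorem outerCoords_succ_left {N : ℕ} {f g : (Fin (N + 1) → K) →ₗ[K] (Fin N → K)}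
    (hf : ∀ e j, f e j = e j.castSucc) (hg : ∀ e j, g e j = e j.succ) (a b : ℕ) :
    outerCoords N a b ⊔ ((outerCoords N a b).comap f).map g = outerCoords N (a + 1) b := by
  apply le_antisymm
  · refine sup_le (fun v hv i h h' => hv i h (by omega)) ?_
    rintro _ ⟨e, he, rfl⟩ i h h'
    have := he ⟨i + 1, by omega⟩ (by simp; omega) (by simp; omega)
    rw [hf] at this
    rw [hg]
    exact this
  · intro v hv
    let u : Fin N → K := fun j => if b ≤ j ∧ j + a < N then v j else 0
    refine Submodule.mem_sup.2
      ⟨v - u, ?_, u, ⟨(Fin.cons 0 u : Fin (N + 1) → K), ?_, ?_⟩, sub_add_cancel v u⟩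
    · intro i h h'
      simp [u, h, h']
    · intro i h h'
      rw [hf]
      rcases i with ⟨_ | i, hi⟩
      · rfl
      · change u ⟨i, by omega⟩ = 0
        simp only [u]
        split_ifs with hb
        · exact hv _ hb.1 (by simp at h' ⊢; omega)
        · rfl
    · funext j
      rw [hg, Fin.cons_succ]

theorem outerCoords_succ_right {N : ℕ} {f g : (Fin (N + 1) → K) →ₗ[K] (Fin N → K)}
    (hf : ∀ e j, f e j = e j.castSucc) (hg : ∀ e j, g e j = e j.succ) (a b : ℕ) :
    outerCoords N a b ⊔ ((outerCoords N a b).comap g).map f = outerCoords N a (b + 1) := by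
  apply le_antisymm
  · refine sup_le (fun v hv i h h' => hv i (by omega) h') ?_
    rintro _ ⟨e, he, rfl⟩ i h h'
    have := he ⟨i - 1, by omega⟩ (by simp; omega) (by simp; omega)
    rw [hg] at this
    rw [hf]
    convert this using 2
    ext
    simp
    omega
  · intro v hv
    let u : Fin N → K := fun j => if b ≤ j ∧ j + a < N then v j else 0
    refine Submodule.mem_sup.2
      ⟨v - u, ?_, u, ⟨(Fin.snoc u 0 : Fin (N + 1) → K), ?_, ?_⟩, sub_add_cancel v u⟩
    · intro i h h'
      simp [u, h, h']
    · intro i h h'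
      rw [hg]
      by_cases hi : (i : ℕ) + 1 < N
      · have : i.succ = Fin.castSucc ⟨i + 1, hi⟩ := rfl
        rw [this, Fin.snoc_castSucc (α := fun _ => K)]
        simp only [u]
        split_ifs with hb
        · exact hv _ (by simp; omega) hb.2
        · rfl
      · have : i.succ = Fin.last N := by ext; simp; omega
        rw [this, Fin.snoc_last (α := fun _ => K)]
    · funext j
      rw [hf, Fin.snoc_castSucc (α := fun _ => K)]

theorem zTz_filt (N m n : ℕ) : (zTz K N).filt m n = outerCoords N m n := by
  have hr : (zTz K N).rstep^[n] ⊥ = outerCoords N 0 n := by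
    induction n with
    | zero =>
      ext v
      exact (Submodule.mem_bot K).trans ⟨fun h i _ _ => congrFun h i,
        fun h => funext fun i => h i (Nat.zero_le _) i.2⟩
    | succ n ih =>
      rw [Function.iterate_succ_apply', ih]
      exact outerCoords_succ_right (zTz_mu N) (zTz_nu N) 0 n
  induction m with
  | zero => exact hr
  | succ m ih =>
    rw [Pair.filt] at ih ⊢
    rw [Function.iterate_succ_apply', ih]
    exact outerCoords_succ_left (zTz_mu N) (zTz_nu N) m n

theorem zTz_codim (N m n : ℕ) : (zTz K N).codim m n = N - m - n := by
  let g : Fin (N - m - n) → Fin N := fun i => ⟨n + i, by omega⟩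
  have hg : Function.Injective g := fun i j h => by
    simp only [g, Fin.mk.injEq] at h
    ext
    omega
  have hker : (zTz K N).filt m n = LinearMap.ker (LinearMap.funLeft K K g) := by
    rw [zTz_filt]
    ext v
    constructor
    · intro hv
      ext i
      exact hv (g i) (by simp [g]) (by simp [g]; omega)
    · intro hv i h h'
      have := congrFun (LinearMap.mem_ker.1 hv) ⟨i - n, by omega⟩
      exact (congrArg v (Fin.ext (by simp [g]; omega))).trans this
  unfold Pair.codim
  rw [hker]
  refine (LinearEquiv.finrank_eq (LinearMap.quotKerEquivOfSurjective _
    (LinearMap.funLeft_surjective_of_injective K K g hg))).trans ?_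
  simp

theorem zTz_delta (N p : ℕ) : (zTz K N).delta p = if N = 2 * p + 1 then 1 else 0 := by
  simp only [Pair.delta, zTz_codim]
  split_ifs <;> omega

theorem Tn_nu_succ (n : ℕ) (e : Fin n → K) (j : Fin n) : (Tn K n).nu e j.succ = e j := by
  change Matrix.toLin' _ e j.succ = _
  simp only [Matrix.toLin'_apply, Matrix.mulVec, dotProduct, Matrix.of_apply, ite_mul, one_mul,
    zero_mul]
  rw [Finset.sum_eq_single j] <;> simp +contextual [Fin.ext_iff, eq_comm]

theorem Tn_nu_injective (n : ℕ) : Function.Injective (Tn K n).nu := fun e e' h =>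
  funext fun j => by
    rw [← Tn_nu_succ n e, h]
    exact Tn_nu_succ n e' j

theorem IsKron.delta_eq {σ : Pair K} (h : IsKron K σ) (p : ℕ)
    [Decidable (Pair.Iso K σ (zTz K (2 * p + 1)))] :
    σ.delta p = if Pair.Iso K σ (zTz K (2 * p + 1)) then 1 else 0 := by
  have hone : Pair.Iso K σ (zTz K (2 * p + 1)) → σ.delta p = 1 := fun hi => by
    rw [hi.delta_eq, zTz_delta, if_pos rfl]
  split_ifs with hi
  · exact hone hi
  rcases h with ⟨n, -, h⟩ | ⟨n, -, h⟩ | ⟨n, h⟩ | ⟨n, h⟩ | ⟨q, n, -, -, -, -, hq, h⟩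
  · rw [h.delta_eq]
    refine Pair.delta_of_nu_injective _ ?_ p
    change Function.Injective (Matrix.toLin' 1)
    rw [Matrix.toLin'_one]
    exact Function.injective_id
  · rw [h.delta_eq]
    refine Pair.delta_of_mu_injective _ ?_ p
    change Function.Injective (Matrix.toLin' 1)
    rw [Matrix.toLin'_one]
    exact Function.injective_id
  · rw [h.delta_eq]
    exact Pair.delta_of_nu_injective _ (Tn_nu_injective n) p
  · rw [h.delta_eq, zTz_delta, if_neg]
    rintro rfl
    exact hi h
  · rw [h.delta_eq]
    exact Pair.delta_of_nu_injective _ Function.injective_id p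

end KroneckerList

section Linearization

variable {K}

theorem sup_map_comap_ker {S R T : Type} [Fintype S] [DecidableEq S] [Fintype R] [DecidableEq R]
    {f g : (R → K) →ₗ[K] (S → K)} {s t : R → S}
    (hf : ∀ e, f (Pi.single e 1) = Pi.single (s e) 1)
    (hg : ∀ e, g (Pi.single e 1) = Pi.single (t e) 1)
    (q : S → T) (hq : Function.Surjective q) (r : T → T → Prop)
    (hr : ∀ α β, r α β ↔ ∃ e e', q (s e) = q (s e') ∧ q (t e) = α ∧ q (t e') = β) :
    LinearMap.ker (Fintype.linearCombination K
        fun x => Finsupp.single (Quot.mk r (q x)) (1 : K)) =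
      LinearMap.ker (Fintype.linearCombination K fun x => Finsupp.single (q x) (1 : K)) ⊔
        ((LinearMap.ker (Fintype.linearCombination K
          fun x => Finsupp.single (q x) (1 : K))).comap f).map g := by
  set Q := Fintype.linearCombination K fun x => Finsupp.single (q x) (1 : K)
  set Q' := Fintype.linearCombination K fun x => Finsupp.single (Quot.mk r (q x)) (1 : K)
  have hQ : ∀ x, Q (Pi.single x 1) = Finsupp.single (q x) 1 := fun x => by simp [Q]
  have hQ' : ∀ x, Q' (Pi.single x 1) = Finsupp.single (Quot.mk r (q x)) 1 := fun x => by
    simp [Q']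
  apply le_antisymm
  · set U := LinearMap.ker Q ⊔ ((LinearMap.ker Q).comap f).map g
    have hfib : ∀ x y, q x = q y →
        U.mkQ (Pi.single x (1 : K)) = U.mkQ (Pi.single y (1 : K)) := fun x y h => by
      rw [← sub_eq_zero, ← map_sub, Submodule.mkQ_apply, Submodule.Quotient.mk_eq_zero]
      refine Submodule.mem_sup_left ?_
      rw [LinearMap.mem_ker, map_sub, hQ, hQ, h, sub_self]
    let F : T → (S → K) ⧸ U := fun α => U.mkQ (Pi.single (Function.surjInv hq α) 1)
    have hF : ∀ x, F (q x) = U.mkQ (Pi.single x 1) := fun x =>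
      hfib _ _ (Function.surjInv_eq hq _)
    let H : Quot r → (S → K) ⧸ U := Quot.lift F fun α β h => by
      obtain ⟨e, e', hs, rfl, rfl⟩ := (hr _ _).1 h
      rw [hF, hF, ← sub_eq_zero, ← map_sub, Submodule.mkQ_apply, Submodule.Quotient.mk_eq_zero]
      refine Submodule.mem_sup_right ⟨Pi.single e 1 - Pi.single e' 1, ?_, ?_⟩
      · rw [SetLike.mem_coe, Submodule.mem_comap, LinearMap.mem_ker, map_sub, map_sub, hf, hf,
          hQ, hQ, hs, sub_self]
      · rw [map_sub, hg, hg]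
    have hcomp : Finsupp.linearCombination K H ∘ₗ Q' = U.mkQ := by
      refine LinearMap.pi_ext' fun x => LinearMap.ext_ring ?_
      simp only [LinearMap.comp_apply, LinearMap.single_apply, hQ', Finsupp.linearCombination_single,
        one_smul]
      exact hF x
    intro v hv
    have h := LinearMap.congr_fun hcomp v
    rw [LinearMap.comp_apply, LinearMap.mem_ker.1 hv, map_zero] at h
    exact (Submodule.Quotient.mk_eq_zero U).1 h.symm
  · refine sup_le ?_ ?_
    · have hcomp : Finsupp.lmapDomain K K (Quot.mk r) ∘ₗ Q = Q' := by
        refine LinearMap.pi_ext' fun x => LinearMap.ext_ring ?_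
        simp [hQ, hQ']
      rw [← hcomp]
      exact LinearMap.ker_le_ker_comp _ _
    · classical
      let G : T → (Quot r →₀ K) := fun ξ =>
        if h : ∃ e, q (s e) = ξ then Finsupp.single (Quot.mk r (q (t h.choose))) 1 else 0
      have hG : ∀ e, G (q (s e)) = Finsupp.single (Quot.mk r (q (t e))) 1 := fun e => by
        have h : ∃ e', q (s e') = q (s e) := ⟨e, rfl⟩
        simp only [G, dif_pos h]
        rw [Quot.sound ((hr _ _).2 ⟨_, e, h.choose_spec, rfl, rfl⟩)]
      have hcomp : Finsupp.linearCombination K G ∘ₗ Q ∘ₗ f = Q' ∘ₗ g := by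
        refine LinearMap.pi_ext' fun e => LinearMap.ext_ring ?_
        simp only [LinearMap.comp_apply, LinearMap.single_apply, hf, hg, hQ, hQ',
          Finsupp.linearCombination_single, one_smul, hG]
      rintro _ ⟨e, he, rfl⟩
      have h := LinearMap.congr_fun hcomp e
      simp only [LinearMap.comp_apply] at h
      rw [LinearMap.mem_ker, ← h, LinearMap.mem_ker.1 he, map_zero]

/-- A map presenting `Δ` as a quotient of `Γ`. -/
def BRel.IsQuotMap (Γ Δ : BRel) (q : Γ.S → Δ.S) : Prop :=
  Function.Surjective q ∧ ∀ α β, Δ.R α β ↔ ∃ a b, q a = α ∧ q b = β ∧ Γ.R a b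

theorem BRel.IsQuotMap.quotBy {Γ Δ : BRel} {q : Γ.S → Δ.S} (h : Γ.IsQuotMap Δ q)
    (r : Δ.S → Δ.S → Prop) : Γ.IsQuotMap (Δ.quotBy r) (fun x => Quot.mk r (q x)) := by
  refine ⟨Quot.mk_surjective.comp h.1, fun α β => ⟨?_, ?_⟩⟩
  · rintro ⟨a, b, rfl, rfl, hab⟩
    obtain ⟨x, y, rfl, rfl, hxy⟩ := (h.2 _ _).1 hab
    exact ⟨x, y, rfl, rfl, hxy⟩
  · rintro ⟨x, y, rfl, rfl, hxy⟩
    exact ⟨q x, q y, rfl, rfl, (h.2 _ _).2 ⟨x, y, rfl, rfl, hxy⟩⟩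

open scoped Classical in
theorem BRel.linz_mu_single (Γ : BRel) (e : {p : Γ.S × Γ.S // Γ.R p.1 p.2}) :
    (Γ.linz K).mu (Pi.single e 1 : {p : Γ.S × Γ.S // Γ.R p.1 p.2} → K) =
      (Pi.single e.1.1 1 : Γ.S → K) := by
  let := Fintype.ofFinite Γ.S
  have : (Pi.single e.1.1 1 : Γ.S → K) = fun v => if e.1.1 = v then 1 else 0 := by
    funext v
    simp [Pi.single_apply, eq_comm]
  rw [this]
  change Matrix.toLin' _ _ = _
  rw [Matrix.toLin'_apply]
  convert Matrix.mulVec_single_one _ e using 1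
  funext v
  simp [Matrix.col_apply]

open scoped Classical in
theorem BRel.linz_nu_single (Γ : BRel) (e : {p : Γ.S × Γ.S // Γ.R p.1 p.2}) :
    (Γ.linz K).nu (Pi.single e 1 : {p : Γ.S × Γ.S // Γ.R p.1 p.2} → K) =
      (Pi.single e.1.2 1 : Γ.S → K) := by
  let := Fintype.ofFinite Γ.S
  have : (Pi.single e.1.2 1 : Γ.S → K) = fun v => if e.1.2 = v then 1 else 0 := by
    funext v
    simp [Pi.single_apply, eq_comm]
  rw [this]
  change Matrix.toLin' _ _ = _
  rw [Matrix.toLin'_apply]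
  convert Matrix.mulVec_single_one _ e using 1
  funext v
  simp [Matrix.col_apply]

/-- The linear extension of a map out of the vertex set of `Γ`. -/
noncomputable def BRel.linMap (Γ : BRel) {T : Type} (q : Γ.S → T) :
    (Γ.linz K).V →ₗ[K] (T →₀ K) :=
  letI := Fintype.ofFinite Γ.S
  Fintype.linearCombination K fun x : Γ.S => Finsupp.single (q x) (1 : K)

theorem BRel.IsQuotMap.ker_lgen {Γ Δ : BRel} {q : Γ.S → Δ.S} (h : Γ.IsQuotMap Δ q) :
    LinearMap.ker (Γ.linMap (K := K) fun x => Quot.mk Δ.lgen (q x)) =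
      (Γ.linz K).lstep (LinearMap.ker (Γ.linMap q)) := by
  classical
  let := Fintype.ofFinite Γ.S
  refine sup_map_comap_ker Γ.linz_mu_single Γ.linz_nu_single q h.1 _ fun α β => ⟨?_, ?_⟩
  · rintro ⟨ξ, h1, h2⟩
    obtain ⟨a, b, rfl, rfl, hab⟩ := (h.2 _ _).1 h1
    obtain ⟨a', b', ha, rfl, hab'⟩ := (h.2 _ _).1 h2
    exact ⟨⟨(a, b), hab⟩, ⟨(a', b'), hab'⟩, ha.symm, rfl, rfl⟩
  · rintro ⟨⟨⟨a, b⟩, hab⟩, ⟨⟨a', b'⟩, hab'⟩, ha, rfl, rfl⟩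
    exact ⟨q a, (h.2 _ _).2 ⟨a, b, rfl, rfl, hab⟩, (h.2 _ _).2 ⟨a', b', ha.symm, rfl, hab'⟩⟩

theorem BRel.IsQuotMap.ker_rgen {Γ Δ : BRel} {q : Γ.S → Δ.S} (h : Γ.IsQuotMap Δ q) :
    LinearMap.ker (Γ.linMap (K := K) fun x => Quot.mk Δ.rgen (q x)) =
      (Γ.linz K).rstep (LinearMap.ker (Γ.linMap q)) := by
  classical
  let := Fintype.ofFinite Γ.S
  refine sup_map_comap_ker Γ.linz_nu_single Γ.linz_mu_single q h.1 _ fun α β => ⟨?_, ?_⟩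
  · rintro ⟨ξ, h1, h2⟩
    obtain ⟨a, b, rfl, rfl, hab⟩ := (h.2 _ _).1 h1
    obtain ⟨a', b', rfl, hb, hab'⟩ := (h.2 _ _).1 h2
    exact ⟨⟨(a, b), hab⟩, ⟨(a', b'), hab'⟩, hb.symm, rfl, rfl⟩
  · rintro ⟨⟨⟨a, b⟩, hab⟩, ⟨⟨a', b'⟩, hab'⟩, hb, rfl, rfl⟩
    exact ⟨q b, (h.2 _ _).2 ⟨a, b, rfl, rfl, hab⟩, (h.2 _ _).2 ⟨a', b', rfl, hb.symm, hab'⟩⟩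

theorem linearCombination_single_injective {S : Type} [Fintype S] :
    Function.Injective (Fintype.linearCombination K fun x : S => Finsupp.single x (1 : K)) := by
  classical
  intro v w h
  funext x
  simpa [Fintype.linearCombination_apply, Finsupp.finsetSum_apply, Finsupp.single_apply]
    using DFunLike.congr_fun h x

theorem linearCombination_single_surjective {S T : Type} [Fintype S] {q : S → T}
    (hq : Function.Surjective q) :
    Function.Surjective
      (Fintype.linearCombination K fun x => Finsupp.single (q x) (1 : K)) := by
  classical
  intro w
  induction w using Finsupp.induction_linear with
  | zero => exact ⟨0, map_zero _⟩
  | add u v hu hv =>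
    obtain ⟨u, rfl⟩ := hu
    obtain ⟨v, rfl⟩ := hv
    exact ⟨u + v, map_add _ _ _⟩
  | single t c =>
    obtain ⟨x, rfl⟩ := hq t
    exact ⟨Pi.single x c, by simp⟩

theorem BRel.exists_isQuotMap_ker_eq_filt (Γ : BRel) (m n : ℕ) :
    ∃ q : Γ.S → (BRel.Cl^[m] (BRel.Cr^[n] Γ)).S,
      Γ.IsQuotMap _ q ∧ LinearMap.ker (Γ.linMap q) = (Γ.linz K).filt m n := by
  have hr : ∃ q : Γ.S → (BRel.Cr^[n] Γ).S,
      Γ.IsQuotMap _ q ∧ LinearMap.ker (Γ.linMap q) = (Γ.linz K).rstep^[n] ⊥ := by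
    induction n with
    | zero =>
      let := Fintype.ofFinite Γ.S
      refine ⟨id, ⟨Function.surjective_id, fun α β => ⟨fun h => ⟨α, β, rfl, rfl, h⟩, ?_⟩⟩,
        LinearMap.ker_eq_bot.2 (linearCombination_single_injective (S := Γ.S))⟩
      rintro ⟨a, b, rfl, rfl, h⟩
      exact h
    | succ n ih =>
      obtain ⟨q, hq, hker⟩ := ih
      rw [Function.iterate_succ_apply', Function.iterate_succ_apply', ← hker]
      exact ⟨_, hq.quotBy _, hq.ker_rgen⟩
  induction m with
  | zero => exact hr
  | succ m ih =>
    obtain ⟨q, hq, hker⟩ := ih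
    rw [Pair.filt] at hker ⊢
    rw [Function.iterate_succ_apply', Function.iterate_succ_apply', ← hker]
    exact ⟨_, hq.quotBy _, hq.ker_lgen⟩

theorem BRel.gamma_eq_codim (Γ : BRel) (m n : ℕ) : Γ.gamma m n = (Γ.linz K).codim m n := by
  obtain ⟨q, hq, hker⟩ := Γ.exists_isQuotMap_ker_eq_filt (K := K) m n
  unfold BRel.gamma Pair.codim
  let := Fintype.ofFinite Γ.S
  let := Fintype.ofFinite (BRel.Cl^[m] (BRel.Cr^[n] Γ)).S
  rw [← hker, LinearEquiv.finrank_eq (LinearMap.quotKerEquivOfSurjective _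
    (linearCombination_single_surjective hq.1)), Module.finrank_finsupp_self, Nat.card_eq_fintype_card]

end Linearization

/-- The multiplicity of `^0T^0_{2p+1}` in a Kronecker decomposition of
`K(Γ)` is `γ_{p,p} − γ_{p,p+1} − γ_{p+1,p} + γ_{p+1,p+1}`. -/
theorem stmt6 (K : Type) [Field K] (Γ : BRel) (k : ℕ) (τ : Fin k → Pair K)
    (hτ : ∀ i, IsKron K (τ i)) (h : Pair.Iso K (Γ.linz K) (dSum K (Fin k) τ))
    (p : ℕ) :
    (Nat.card {i : Fin k // Pair.Iso K (τ i) (zTz K (2*p+1))} : ℤ) =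
      (Γ.gamma p p : ℤ) - (Γ.gamma p (p+1) : ℤ)
        - (Γ.gamma (p+1) p : ℤ) + (Γ.gamma (p+1) (p+1) : ℤ) := by
  classical
  rw [Γ.gamma_eq_codim (K := K), Γ.gamma_eq_codim (K := K), Γ.gamma_eq_codim (K := K),
    Γ.gamma_eq_codim (K := K)]
  change _ = (Γ.linz K).delta p
  rw [h.delta_eq, dSum_delta, Finset.sum_congr rfl fun i _ => (hτ i).delta_eq p,
    Finset.sum_boole, Nat.card_eq_fintype_card, Fintype.card_subtype]

end Towber
end
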